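/- arXiv:1101.1798 — 5 statements merged into one kernel-verified Lean document; each statement's English description precedes it below -/
import Mathlib

section
/- For natural numbers n, m, s with 1 ≤ m ≤ n and s ≥ 2, the polynomial identity Σ_{k=0}^m K_{k,n,s}(X) = K_{m,n−1,s}(X−1) holds. -/
open Polynomial Finset

/-- `P j` is the polynomial `X(X-1)⋯(X-j+1)/j!` (with `P 0 = 1`). -/
noncomputable def P (j : ℕ) : Polynomial ℝ :=
  Polynomial.C (1 / (j.factorial : ℝ)) *
    ∏ i ∈ Finset.range j, (Polynomial.X - Polynomial.C (i : ℝ))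

/-- The Krawtchouk polynomial `K_{m,n,s}(X) = Σ_{j=0}^m (-1)^j P_j(X) P_{m-j}(n-X) (s-1)^{m-j}`. -/
noncomputable def K (m n s : ℕ) : Polynomial ℝ :=
  ∑ j ∈ Finset.range (m + 1),
    Polynomial.C ((-1 : ℝ) ^ j * ((s : ℝ) - 1) ^ (m - j)) *
      (P j * (P (m - j)).comp (Polynomial.C (n : ℝ) - Polynomial.X))

theorem P_comp_X_sub_one (j : ℕ) :
    (P j).comp (X - 1) =
      C (1 / (j.factorial : ℝ)) * ∏ i ∈ range j, (X - C ((i + 1 : ℕ) : ℝ)) := by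
  simp only [P, mul_comp, C_comp, Polynomial.prod_comp, sub_comp, X_comp]
  congr 1
  refine prod_congr rfl fun i _ => ?_
  push_cast
  simp only [map_add, map_one]
  ring

/-- Pascal's rule for the binomial polynomials. -/
theorem P_succ (j : ℕ) :
    P (j + 1) = (P (j + 1)).comp (X - 1) + (P j).comp (X - 1) := by
  have hfac : (C (1 / (j.factorial : ℝ)) : ℝ[X]) =
      C (1 / ((j + 1).factorial : ℝ)) * C ((j + 1 : ℕ) : ℝ) := by
    rw [← C_mul, Nat.factorial_succ]
    congr 1
    have := Nat.factorial_ne_zero j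
    push_cast
    field_simp
  rw [P_comp_X_sub_one, P_comp_X_sub_one, hfac, P, prod_range_succ', prod_range_succ]
  simp only [Nat.cast_zero, C_0]
  ring

/-- Summing the convolutions of `a` with `c` gives the convolution of `b` with `c`, when `a` is
the sequence of differences of `b`. -/
theorem sum_range_convolution {R : Type*} [CommRing R] (a b c : ℕ → R) (h0 : a 0 = b 0)
    (hsucc : ∀ j, a (j + 1) = b (j + 1) - b j) (m : ℕ) :
    ∑ k ∈ range (m + 1), ∑ j ∈ range (k + 1), a j * c (k - j) =
      ∑ j ∈ range (m + 1), b j * c (m - j) := by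
  induction m with
  | zero => simp [h0]
  | succ m ih =>
    rw [sum_range_succ, ih, sum_range_succ' _ (m + 1), sum_range_succ' (fun j => b j * _) (m + 1)]
    simp only [hsucc, h0, sub_mul, sum_sub_distrib, Nat.add_sub_add_right]
    ring

theorem krawtchouk_sum (n m s : ℕ) (hm1 : 1 ≤ m) (hmn : m ≤ n) (hs : 2 ≤ s) :
    ∑ k ∈ Finset.range (m + 1), K k n s =
      (K m (n - 1) s).comp (Polynomial.X - 1) := by
  have hn : ((n - 1 : ℕ) : ℝ) = n - 1 := by
    rw [Nat.cast_sub (hm1.trans hmn), Nat.cast_one]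
  have hcomp : (C ((n - 1 : ℕ) : ℝ) - X : ℝ[X]).comp (X - 1) = C (n : ℝ) - X := by
    simp only [hn, sub_comp, C_comp, X_comp, map_sub, map_one, one_comp]
    ring
  have key := sum_range_convolution (fun j => C ((-1 : ℝ) ^ j) * P j)
    (fun j => C ((-1 : ℝ) ^ j) * (P j).comp (X - 1))
    (fun i => C (((s : ℝ) - 1) ^ i) * (P i).comp (C (n : ℝ) - X))
    (by simp [P])
    (fun j => by
      simp only [pow_succ, C_mul, C_neg, map_one]
      linear_combination (-C ((-1 : ℝ) ^ j)) * P_succ j) m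
  simp only [K, Polynomial.sum_comp, mul_comp, C_comp, comp_assoc, hcomp, C_mul]
  simpa only [mul_assoc, mul_left_comm, mul_comm] using key
end

section
/- For natural numbers n, s with s ≥ 2 and for integers k, l with 0 ≤ k, l ≤ n and k ≠ l, one has Σ_{i=0}^n C(n,i) (s−1)^i K_{k,n,s}(i) K_{l,n,s}(i) = 0. -/
open Polynomial Finset

theorem P_eval_natCast (j m : ℕ) : (P j).eval (m : ℝ) = (m.choose j : ℝ) := by
  have h : (∏ i ∈ Finset.range j, ((m : ℝ) - (i : ℝ))) = (m.descFactorial j : ℝ) := by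
    rw [← descPochhammer_eval_eq_prod_range, descPochhammer_eval_eq_descFactorial]
  have hj : (j.factorial : ℝ) ≠ 0 := by exact_mod_cast j.factorial_ne_zero
  simp only [P, eval_mul, eval_C, eval_prod, eval_sub, eval_X]
  rw [h, Nat.descFactorial_eq_factorial_mul_choose]
  push_cast
  field_simp

theorem coeff_one_add_C_mul_X_pow (a : ℝ) (m j : ℕ) :
    ((1 + C a * X : ℝ[X]) ^ m).coeff j = (m.choose j : ℝ) * a ^ j := by
  have h : (1 + C a * X : ℝ[X]) ^ m = ((1 + X : ℝ[X]) ^ m).comp (C a * X) := by simp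
  rw [h, comp_C_mul_X_coeff, coeff_one_add_X_pow]

/-- The generating polynomial of the values at `i` of the Krawtchouk polynomials. -/
noncomputable def krawtchoukGen (q : ℝ) (n i : ℕ) : ℝ[X] :=
  (1 + C (-1) * X) ^ i * (1 + C q * X) ^ (n - i)

theorem K_eval_eq_coeff_krawtchoukGen (m n s i : ℕ) (hi : i ≤ n) :
    (K m n s).eval (i : ℝ) = (krawtchoukGen ((s : ℝ) - 1) n i).coeff m := by
  rw [krawtchoukGen, coeff_mul, Finset.Nat.sum_antidiagonal_eq_sum_range_succ_mk, K,
    eval_finsetSum]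
  refine Finset.sum_congr rfl fun j _ => ?_
  simp only [coeff_one_add_C_mul_X_pow, eval_mul, eval_C, eval_comp, eval_sub, eval_X,
    ← Nat.cast_sub hi, P_eval_natCast]
  ring

/-- Bivariate generating function of the weighted products of Krawtchouk values. -/
theorem sum_krawtchoukGen_mul (q : ℝ) (n : ℕ) :
    ∑ i ∈ Finset.range (n + 1), C (C ((n.choose i : ℝ) * q ^ i)) *
        (C (krawtchoukGen q n i) * (krawtchoukGen q n i).map C) =
      (C (C (q * (q + 1))) * (C X * X) + C (C (q + 1)) : ℝ[X][X]) ^ n := by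
  have h : (C (C (q * (q + 1))) * (C X * X) + C (C (q + 1)) : ℝ[X][X]) =
      C (C q) * ((1 - C X) * (1 - X)) +
        (1 + C (C q) * C X) * (1 + C (C q) * X) := by
    simp only [C_mul, C_add, C_1]
    ring
  rw [h, add_pow]
  refine Finset.sum_congr rfl fun i _ => ?_
  simp only [krawtchoukGen, Polynomial.map_mul, Polynomial.map_pow, Polynomial.map_add,
    Polynomial.map_one, Polynomial.map_neg, map_C, map_X, C_mul, C_add, C_pow, C_1, C_neg, map_natCast, mul_pow]
  ring

theorem coeff_coeff_mul_add_pow_of_ne (a b : ℝ) (n : ℕ) {k l : ℕ} (hkl : k ≠ l) :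
    (((C (C a) * (C X * X) + C (C b) : ℝ[X][X]) ^ n).coeff l).coeff k = 0 := by
  rw [add_pow, finsetSum_coeff, finsetSum_coeff]
  refine Finset.sum_eq_zero fun m _ => ?_
  have h : (C (C a) * (C X * X) : ℝ[X][X]) ^ m * C (C b) ^ (n - m) * (n.choose m : ℝ[X][X]) =
      C (C (a ^ m * b ^ (n - m) * (n.choose m : ℝ)) * X ^ m) * X ^ m := by
    simp only [C_mul, C_pow, map_natCast, mul_pow]
    ring
  rw [h, coeff_C_mul_X_pow]
  split_ifs with hl
  · rw [coeff_C_mul_X_pow, if_neg (hl ▸ hkl)]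
  · exact coeff_zero k

theorem krawtchouk_orthogonal (n s : ℕ) (hs : 2 ≤ s) (k l : ℕ)
    (hk : k ≤ n) (hl : l ≤ n) (hkl : k ≠ l) :
    ∑ i ∈ Finset.range (n + 1),
      (n.choose i : ℝ) * ((s : ℝ) - 1) ^ i *
        ((K k n s).eval (i : ℝ) * (K l n s).eval (i : ℝ)) = 0 := by
  have h := congrArg (fun p : ℝ[X][X] => (p.coeff l).coeff k)
    (sum_krawtchoukGen_mul ((s : ℝ) - 1) n)
  simp only [coeff_coeff_mul_add_pow_of_ne _ _ _ hkl, finsetSum_coeff, coeff_C_mul, coeff_map,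
    coeff_mul_C] at h
  rw [← h]
  refine Finset.sum_congr rfl fun i hi => ?_
  have hin : i ≤ n := Nat.lt_succ_iff.mp (Finset.mem_range.mp hi)
  rw [K_eval_eq_coeff_krawtchoukGen k n s i hin, K_eval_eq_coeff_krawtchoukGen l n s i hin]
end

section
/- For natural numbers n, s with s ≥ 2 and for every integer k with 0 ≤ k ≤ n, one has Σ_{i=0}^n C(n,i) (s−1)^i K_{k,n,s}(i)^2 = s^n (s−1)^k C(n,k). -/
open Polynomial Finset

theorem coeff_one_add_C_mul_X_pow_s10 {R : Type*} [CommRing R] (a : R) (n k : ℕ) :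
    ((1 + Polynomial.C a * Polynomial.X : Polynomial R) ^ n).coeff k = (n.choose k : R) * a ^ k := by
  have h : (1 + Polynomial.C a * Polynomial.X : Polynomial R) ^ n =
      ((1 + Polynomial.X) ^ n).comp (Polynomial.C a * Polynomial.X) := by simp
  rw [h, Polynomial.comp_C_mul_X_coeff, Polynomial.coeff_one_add_X_pow]

/-- The values of the Krawtchouk polynomials have generating function
`(1 - z)^i (1 + (s - 1) z)^(n - i)`. -/
theorem K_eval_natCast (k n s i : ℕ) (hi : i ≤ n) :
    (K k n s).eval (i : ℝ) =
      ((1 + Polynomial.C (-1 : ℝ) * Polynomial.X) ^ i *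
        (1 + Polynomial.C ((s : ℝ) - 1) * Polynomial.X) ^ (n - i)).coeff k := by
  rw [Polynomial.coeff_mul, Finset.Nat.sum_antidiagonal_eq_sum_range_succ_mk, K,
    Polynomial.eval_finsetSum]
  refine Finset.sum_congr rfl fun j _ => ?_
  simp only [coeff_one_add_C_mul_X_pow_s10, Polynomial.eval_mul, Polynomial.eval_C,
    Polynomial.eval_comp, Polynomial.eval_sub, Polynomial.eval_X, ← Nat.cast_sub hi,
    P_eval_natCast]
  ring

/-- The product generating function in `ℝ[z][w]`, summed by the binomial theorem. -/
theorem sum_generating_function_mul (q : ℝ) (n : ℕ) :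
    ∑ i ∈ Finset.range (n + 1),
      Polynomial.C (Polynomial.C ((n.choose i : ℝ) * q ^ i)) *
        (((1 + Polynomial.C (-1 : ℝ) * Polynomial.X) ^ i *
            (1 + Polynomial.C q * Polynomial.X) ^ (n - i)).map Polynomial.C *
          Polynomial.C ((1 + Polynomial.C (-1 : ℝ) * Polynomial.X) ^ i *
            (1 + Polynomial.C q * Polynomial.X) ^ (n - i))) =
      Polynomial.C (Polynomial.C ((q + 1) ^ n)) *
        (1 + Polynomial.C (Polynomial.C q * Polynomial.X) * Polynomial.X) ^ n := by
  have h : Polynomial.C (Polynomial.C (q + 1)) *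
        (1 + Polynomial.C (Polynomial.C q * Polynomial.X) * Polynomial.X) =
      Polynomial.C (Polynomial.C q) * (1 - Polynomial.X) * (1 - Polynomial.C Polynomial.X) +
        (1 + Polynomial.C (Polynomial.C q) * Polynomial.X) *
          (1 + Polynomial.C (Polynomial.C q) * Polynomial.C Polynomial.X) := by
    simp only [map_add, map_mul, map_one]
    ring
  rw [map_pow, map_pow, ← mul_pow, h, add_pow]
  refine Finset.sum_congr rfl fun i _ => ?_
  simp only [Polynomial.map_mul, Polynomial.map_pow, Polynomial.map_sub,
    Polynomial.map_add, Polynomial.map_one,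
    Polynomial.map_C, Polynomial.map_X, map_mul, map_pow, map_sub, map_add, map_neg, map_one,
    map_natCast, mul_pow, neg_mul, one_mul, ← sub_eq_add_neg]
  ring

theorem krawtchouk_norm (n s : ℕ) (hs : 2 ≤ s) (k : ℕ) (hk : k ≤ n) :
    ∑ i ∈ Finset.range (n + 1),
      (n.choose i : ℝ) * ((s : ℝ) - 1) ^ i * ((K k n s).eval (i : ℝ)) ^ 2 =
      (s : ℝ) ^ n * ((s : ℝ) - 1) ^ k * (n.choose k : ℝ) := by
  have h := congrArg (fun p => (p.coeff k).coeff k) (sum_generating_function_mul ((s : ℝ) - 1) n)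
  simp only [Polynomial.finsetSum_coeff, Polynomial.coeff_C_mul, Polynomial.coeff_mul_C,
    Polynomial.coeff_map, coeff_one_add_C_mul_X_pow_s10, sub_add_cancel, mul_pow,
    ← Polynomial.C_pow, ← Polynomial.C_eq_natCast, Polynomial.coeff_X_pow_self] at h
  rw [mul_one, mul_comm (n.choose k : ℝ), ← mul_assoc] at h
  rw [← h]
  refine Finset.sum_congr rfl fun i hi => ?_
  rw [K_eval_natCast k n s i (Nat.lt_succ_iff.mp (Finset.mem_range.mp hi)), sq]
end

section
/- For natural numbers n, m, s with 1 ≤ m ≤ n−1 and s ≥ 2, if x_1 < x_2 < ⋯ < x_m are the roots of K_{m,n,s} and y_1 < y_2 < ⋯ < y_{m+1} are the roots of K_{m+1,n,s}, then 0 < y_1 < x_1 < y_2 < x_2 < ⋯ < x_m < y_{m+1} < n; that is, the roots of successive Krawtchouk polynomials strictly interlace. -/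
open Polynomial Finset

theorem eval_P (j : ℕ) (t : ℝ) :
    (P j).eval t = 1 / (j.factorial : ℝ) * ∏ i ∈ Finset.range j, (t - i) := by
  simp [P, Polynomial.eval_prod]

theorem succ_mul_eval_P_succ (j : ℕ) (t : ℝ) :
    ((j : ℝ) + 1) * (P (j + 1)).eval t = (t - j) * (P j).eval t := by
  have hj : (j.factorial : ℝ) ≠ 0 := by positivity
  rw [eval_P, eval_P, Finset.prod_range_succ, Nat.factorial_succ]
  push_cast
  field_simp

theorem eval_P_pos {j : ℕ} {t : ℝ} (h : (j : ℝ) ≤ t) : 0 < (P j).eval t := by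
  rw [eval_P]
  refine mul_pos (by positivity) (Finset.prod_pos fun i hi => ?_)
  have : (i : ℝ) < j := by exact_mod_cast Finset.mem_range.mp hi
  linarith

theorem neg_one_pow_mul_eval_P_nonneg (j : ℕ) {t : ℝ} (h : t ≤ 0) :
    0 ≤ (-1) ^ j * (P j).eval t := by
  have : (-1) ^ j * (P j).eval t = 1 / (j.factorial : ℝ) * ∏ i ∈ Finset.range j, (i - t) := by
    rw [eval_P, mul_left_comm, ← Finset.card_range j, ← Finset.prod_const, Finset.card_range,
      ← Finset.prod_mul_distrib]
    simp
  rw [this]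
  refine mul_nonneg (by positivity) (Finset.prod_nonneg fun i _ => ?_)
  have : (0 : ℝ) ≤ i := i.cast_nonneg
  linarith

theorem eval_K (m n s : ℕ) (t : ℝ) :
    (K m n s).eval t = ∑ j ∈ Finset.range (m + 1),
      ((-1) ^ j * (P j).eval t) * (((s : ℝ) - 1) ^ (m - j) * (P (m - j)).eval (n - t)) := by
  simp only [K, Polynomial.eval_finsetSum, Polynomial.eval_mul, Polynomial.eval_C,
    Polynomial.eval_comp, Polynomial.eval_sub, Polynomial.eval_X]
  exact Finset.sum_congr rfl fun j _ => by ring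

theorem eval_K_pos_of_nonpos {m n s : ℕ} (hmn : m ≤ n) (hs : 2 ≤ s) {t : ℝ} (ht : t ≤ 0) :
    0 < (K m n s).eval t := by
  have hs' : (0 : ℝ) < s - 1 := by
    have : (2 : ℝ) ≤ s := by exact_mod_cast hs
    linarith
  have hP : ∀ j ≤ m, 0 < (P j).eval (n - t) := fun j hj => eval_P_pos (by
    have : (j : ℝ) ≤ n := by exact_mod_cast hj.trans hmn
    linarith)
  rw [eval_K]
  refine Finset.sum_pos' (fun j _ => mul_nonneg (neg_one_pow_mul_eval_P_nonneg j ht)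
    (mul_pos (by positivity) (hP _ (by lia))).le) ⟨0, by simp, ?_⟩
  have := hP m le_rfl
  simp only [P.eq_1 0]
  simp
  positivity

theorem neg_one_pow_mul_eval_K_pos_of_le {m n s : ℕ} (hmn : m ≤ n) (hs : 2 ≤ s) {t : ℝ}
    (ht : (n : ℝ) ≤ t) : 0 < (-1) ^ m * (K m n s).eval t := by
  have hs' : (0 : ℝ) < s - 1 := by
    have : (2 : ℝ) ≤ s := by exact_mod_cast hs
    linarith
  have hP : ∀ j ≤ m, 0 < (P j).eval t := fun j hj => eval_P_pos (by
    have : (j : ℝ) ≤ n := by exact_mod_cast hj.trans hmn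
    linarith)
  have key : (-1) ^ m * (K m n s).eval t = ∑ j ∈ Finset.range (m + 1),
      ((P j).eval t * ((s : ℝ) - 1) ^ (m - j)) *
        ((-1) ^ (m - j) * (P (m - j)).eval (n - t)) := by
    rw [eval_K, Finset.mul_sum]
    refine Finset.sum_congr rfl fun j hj => ?_
    obtain ⟨k, rfl⟩ := Nat.exists_eq_add_of_le (Nat.lt_succ_iff.mp (Finset.mem_range.mp hj))
    have hsq : ((-1 : ℝ) ^ j) * (-1) ^ j = 1 := by rw [← mul_pow]; simp
    rw [Nat.add_sub_cancel_left, pow_add]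
    linear_combination (-1 : ℝ) ^ k * (P j).eval t *
      ((s : ℝ) - 1) ^ k * (P k).eval (n - t) * hsq
  rw [key]
  refine Finset.sum_pos' (fun j hj => mul_nonneg
    (mul_pos (hP j (by simpa [Nat.lt_succ_iff] using hj)) (by positivity)).le
    (neg_one_pow_mul_eval_P_nonneg _ (by linarith))) ⟨m, by simp, ?_⟩
  have := hP m le_rfl
  simpa [P.eq_1 0] using this

/-- The binomial series `(1 + c z) ^ t`. -/
noncomputable def binomialPowerSeries (c t : ℝ) : PowerSeries ℝ :=
  PowerSeries.mk fun j => c ^ j * (P j).eval t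

theorem one_add_mul_derivative_binomialPowerSeries (c t : ℝ) :
    (1 + PowerSeries.C c * PowerSeries.X) *
        PowerSeries.derivative ℝ (binomialPowerSeries c t) =
      PowerSeries.C (c * t) * binomialPowerSeries c t := by
  ext j
  rw [add_mul, one_mul, mul_assoc, map_add, PowerSeries.coeff_C_mul, PowerSeries.coeff_C_mul]
  cases j with
  | zero =>
    have := succ_mul_eval_P_succ 0 t
    simp [PowerSeries.coeff_derivative, binomialPowerSeries] at this ⊢
    linear_combination c * this
  | succ j =>
    have := succ_mul_eval_P_succ (j + 1) t
    rw [PowerSeries.coeff_succ_X_mul]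
    simp only [PowerSeries.coeff_derivative, binomialPowerSeries, PowerSeries.coeff_mk]
    push_cast at this ⊢
    linear_combination c ^ (j + 2) * this

theorem coeff_binomialPowerSeries_mul (m n s : ℕ) (t : ℝ) :
    PowerSeries.coeff m (binomialPowerSeries (-1) t * binomialPowerSeries (s - 1) (n - t)) =
      (K m n s).eval t := by
  rw [PowerSeries.coeff_mul, Finset.Nat.sum_antidiagonal_eq_sum_range_succ_mk, eval_K]
  simp [binomialPowerSeries]

/-- The generating function `(1 - z) ^ t * (1 + (s - 1) z) ^ (n - t)` of the Krawtchouk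
polynomials satisfies a first order linear differential equation. -/
theorem derivative_generatingFunction (c d a b : ℝ) :
    (1 + PowerSeries.C (c + d) * PowerSeries.X + PowerSeries.C (c * d) * PowerSeries.X ^ 2) *
        PowerSeries.derivative ℝ (binomialPowerSeries c a * binomialPowerSeries d b) =
      (PowerSeries.C (c * a + d * b) + PowerSeries.C (c * d * (a + b)) * PowerSeries.X) *
        (binomialPowerSeries c a * binomialPowerSeries d b) := by
  have h₁ := one_add_mul_derivative_binomialPowerSeries c a
  have h₂ := one_add_mul_derivative_binomialPowerSeries d b
  rw [Derivation.leibniz, smul_eq_mul, smul_eq_mul]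
  simp only [map_add, map_mul] at h₁ h₂ ⊢
  linear_combination
    (1 + PowerSeries.C d * PowerSeries.X) * binomialPowerSeries d b * h₁ +
    (1 + PowerSeries.C c * PowerSeries.X) * binomialPowerSeries c a * h₂

theorem eval_K_recurrence (m n s : ℕ) (t : ℝ) :
    ((m : ℝ) + 2) * (K (m + 2) n s).eval t =
      ((n - t) * (s - 1) - t - (s - 2) * (m + 1)) * (K (m + 1) n s).eval t -
        (s - 1) * (n - m) * (K m n s).eval t := by
  have h := congrArg (PowerSeries.coeff (m + 1))
    (derivative_generatingFunction (-1) (s - 1) t (n - t))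
  simp only [add_mul, one_mul, mul_assoc, map_add (PowerSeries.coeff _), PowerSeries.coeff_C_mul,
    pow_two, PowerSeries.coeff_succ_X_mul] at h
  rw [PowerSeries.coeff_derivative, PowerSeries.coeff_derivative,
    coeff_binomialPowerSeries_mul, coeff_binomialPowerSeries_mul,
    coeff_binomialPowerSeries_mul] at h
  cases m with
  | zero =>
    rw [PowerSeries.coeff_zero_X_mul] at h
    push_cast at h ⊢
    linear_combination h
  | succ m =>
    rw [PowerSeries.coeff_succ_X_mul, PowerSeries.coeff_derivative,
      coeff_binomialPowerSeries_mul] at h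
    push_cast at h ⊢
    linear_combination h

theorem K_recurrence (m n s : ℕ) :
    C ((m : ℝ) + 2) * K (m + 2) n s =
      (C ((n : ℝ) * (s - 1) - (s - 2) * (m + 1)) - C (s : ℝ) * X) * K (m + 1) n s -
        C (((s : ℝ) - 1) * (n - m)) * K m n s := by
  refine Polynomial.funext fun t => ?_
  simp only [eval_mul, eval_sub, eval_C, eval_X]
  linear_combination eval_K_recurrence m n s t

theorem K_zero (n s : ℕ) : K 0 n s = 1 := by
  simp [K, P]

theorem K_one (n s : ℕ) : K 1 n s = C (((s : ℝ) - 1) * n) - C (s : ℝ) * X := by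
  refine Polynomial.funext fun t => ?_
  simp [eval_K, Finset.sum_range_succ, eval_P]
  ring

theorem eval_wronskian_K_neg {m n s : ℕ} (hmn : m ≤ n) (hs : 2 ≤ s) (t : ℝ) :
    (wronskian (K m n s) (K (m + 1) n s)).eval t < 0 := by
  have hs' : (2 : ℝ) ≤ s := by exact_mod_cast hs
  induction m with
  | zero =>
    simp [wronskian, K_zero, K_one]
    lia
  | succ m ih =>
    have hm : (m : ℝ) + 1 ≤ n := by exact_mod_cast hmn
    have hrec := K_recurrence m n s
    have hder := congrArg (eval t ∘ derivative) hrec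
    have hval := congrArg (eval t) hrec
    have ih := ih (by lia)
    have hc : 0 < ((s : ℝ) - 1) * (n - m) := mul_pos (by linarith) (by linarith)
    have hsq : 0 ≤ (s : ℝ) * (eval t (K (m + 1) n s)) ^ 2 := by positivity
    have hstep : ((m : ℝ) + 2) * (wronskian (K (m + 1) n s) (K (m + 2) n s)).eval t =
        (s - 1) * (n - m) * (wronskian (K m n s) (K (m + 1) n s)).eval t -
          s * (eval t (K (m + 1) n s)) ^ 2 := by
      simp only [wronskian, Function.comp_apply, derivative_mul, derivative_sub, derivative_C,
        derivative_X, eval_mul, eval_sub, eval_add, eval_C, eval_X, eval_zero, eval_one]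
        at hder hval ⊢
      linear_combination (K (m + 1) n s).eval t * hder -
        (derivative (K (m + 1) n s)).eval t * hval
    refine neg_of_mul_neg_right (a := (m : ℝ) + 2) ?_ (by positivity)
    rw [hstep]
    linarith [mul_neg_of_pos_of_neg hc ih]

/-- If the Wronskian of `p` and `q` never vanishes, then `p` has a root between any two roots
of `q`. -/
theorem exists_root_between_of_wronskian_ne_zero {p q : ℝ[X]}
    (hw : ∀ t, (wronskian p q).eval t ≠ 0) {a b : ℝ} (hab : a < b)
    (ha : q.eval a = 0) (hb : q.eval b = 0) : ∃ c ∈ Set.Ioo a b, p.eval c = 0 := by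
  by_contra! h
  have hp : ∀ c ∈ Set.Icc a b, p.eval c ≠ 0 := by
    intro c hc hpc
    rcases hc.1.eq_or_lt with rfl | hac
    · exact hw a (by simp [wronskian, ha, hpc])
    rcases hc.2.eq_or_lt with rfl | hcb
    · exact hw c (by simp [wronskian, hb, hpc])
    exact h c ⟨hac, hcb⟩ hpc
  obtain ⟨c, hc, hc0⟩ := exists_hasDerivAt_eq_zero hab
    (f := fun t => q.eval t / p.eval t)
    (f' := fun t => ((derivative q).eval t * p.eval t - q.eval t * (derivative p).eval t) /
      p.eval t ^ 2)
    (q.continuous.continuousOn.div p.continuous.continuousOn hp) (by simp [ha, hb])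
    fun t ht => (q.hasDerivAt t).div (p.hasDerivAt t) (hp t (Set.Ioo_subset_Icc_self ht))
  have hpc := hp c (Set.Ioo_subset_Icc_self hc)
  refine hw c ?_
  rw [div_eq_zero_iff] at hc0
  have := hc0.resolve_right (pow_ne_zero 2 hpc)
  simp only [wronskian, eval_sub, eval_mul]
  linear_combination this

theorem krawtchouk_roots_interlace (n m s : ℕ) (hm1 : 1 ≤ m) (hmn : m + 1 ≤ n)
    (hs : 2 ≤ s) (x : Fin m → ℝ) (y : Fin (m + 1) → ℝ)
    (hx : StrictMono x) (hy : StrictMono y)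
    (hxroot : ∀ t : ℝ, (K m n s).eval t = 0 ↔ ∃ i, x i = t)
    (hyroot : ∀ t : ℝ, (K (m + 1) n s).eval t = 0 ↔ ∃ i, y i = t) :
    0 < y 0 ∧ (∀ i : Fin m, y i.castSucc < x i ∧ x i < y i.succ) ∧
      y (Fin.last m) < (n : ℝ) := by
  have hy0 : ∀ i, (K (m + 1) n s).eval (y i) = 0 := fun i => (hyroot _).mpr ⟨i, rfl⟩
  refine ⟨?_, ?_, ?_⟩
  · by_contra! h
    exact (eval_K_pos_of_nonpos hmn hs h).ne' (hy0 0)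
  · choose z hz hz0 using fun i : Fin m => exists_root_between_of_wronskian_ne_zero
      (fun t => (eval_wronskian_K_neg (by lia : m ≤ n) hs t).ne)
      (hy (Fin.castSucc_lt_succ (i := i))) (hy0 _) (hy0 _)
    choose σ hσ using fun i => (hxroot _).mp (hz0 i)
    have hσ_mono : StrictMono σ := fun i j hij => by
      rw [← hx.lt_iff_lt, hσ, hσ]
      have : y i.succ ≤ y j.castSucc := hy.monotone (by simpa [Fin.le_def] using hij)
      exact (hz i).2.trans_le (this.trans (hz j).1.le)
    intro i
    rw [show x i = z i by rw [← hσ i, hσ_mono.eq_id, id]]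
    exact hz i
  · by_contra! h
    exact (neg_one_pow_mul_eval_K_pos_of_le hmn hs h).ne' (by rw [hy0, mul_zero])
end

section
/- For natural numbers n, m with m ≤ n, a real number x is a root of K_{m,n,2} if and only if n − x is a root of K_{m,n,2}; in particular, if m is odd, then n/2 is a root of K_{m,n,2}. -/
open Polynomial Finset

/-- The reflection `x ↦ n - x` multiplies the binary Krawtchouk polynomial by `(-1) ^ m`. -/
theorem eval_K_two_sub (m n : ℕ) (x : ℝ) :
    (K m n 2).eval ((n : ℝ) - x) = (-1) ^ m * (K m n 2).eval x := by
  simp only [K, eval_finsetSum, eval_mul, eval_comp, eval_C, eval_sub, eval_X, mul_sum]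
  rw [← sum_range_reflect]
  refine sum_congr rfl fun j hj => ?_
  obtain ⟨k, rfl⟩ := Nat.exists_eq_add_of_le (mem_range_succ_iff.mp hj)
  have hk : j + k + 1 - 1 - j = k := by omega
  have hj' : j + k - k = j := by omega
  have hk' : j + k - j = k := by omega
  have hsign : (-1 : ℝ) ^ j * (-1) ^ j = 1 := by rw [← mul_pow]; norm_num
  have hbase : ((2 : ℕ) : ℝ) - 1 = 1 := by norm_num
  simp only [hk, hj', hk', hbase, sub_sub_cancel, one_pow, mul_one, pow_add]
  linear_combination (-(-1 : ℝ) ^ k * (P j).eval x * (P k).eval ((n : ℝ) - x)) * hsign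

theorem krawtchouk_roots_symmetric (n m : ℕ) (hm : m ≤ n) :
    (∀ x : ℝ, (K m n 2).eval x = 0 ↔ (K m n 2).eval ((n : ℝ) - x) = 0) ∧
      (Odd m → (K m n 2).eval ((n : ℝ) / 2) = 0) := by
  refine ⟨fun x => ?_, fun hodd => ?_⟩
  · simp [eval_K_two_sub]
  · have h := eval_K_two_sub m n ((n : ℝ) / 2)
    rw [sub_half, hodd.neg_one_pow] at h
    linarith
end
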